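/- (F-inversion of adjunction, F-pure case.) Let (R, m) be an F-finite regular local ring of prime characteristic p > 0 and I ⊊ R an unmixed reduced ideal of height h > 0. Let a₁,…,a_k be ideals of R and t₁,…,t_k > 0 real numbers, and write S = R/I. If the pair (S, (a₁S)^{t₁}⋯(a_kS)^{t_k}) is F-pure, then the pair (R, I¹·a₁^{t₁}⋯a_k^{t_k}) (the pair with ideals I, a₁,…,a_k and exponents 1, t₁,…,t_k) is F-pure. -/

import Mathlib

/-!  Common definitions: F-singularities of pairs `(R, a₁^{t₁} ⋯ a_k^{t_k})`
(Takagi, "F-singularities of pairs and Inversion of Adjunction of arbitrary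
codimension"). -/

/-- The subring of `p`-th powers of `R`. -/
def pthPowers (R : Type*) [CommRing R] (p : ℕ) : Subring R :=
  Subring.closure (Set.range fun x : R => x ^ p)

/-- `R` is F-finite: it is a finitely generated module over its subring of `p`-th powers. -/
def FFinite (R : Type*) [CommRing R] (p : ℕ) : Prop :=
  Module.Finite (pthPowers R p) R

/-- `c^{1/q} R → R^{1/q}` splits as an `R`-module homomorphism: there is an additive
map `φ : R → R` with `φ (a ^ q * x) = a * φ x` for all `a x` and `φ c = 1`. -/
def SplitsAlong (R : Type*) [CommRing R] (c : R) (q : ℕ) : Prop :=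
  ∃ φ : R →+ R, (∀ a x : R, φ (a ^ q * x) = a * φ x) ∧ φ c = 1

/-- Membership in `R°`: `c` lies in no minimal prime of `R`. -/
def NotInMinimalPrimes (R : Type*) [CommRing R] (c : R) : Prop :=
  ∀ P ∈ minimalPrimes R, c ∉ P

/-- F-purity of the pair `(R, a₁^{t₁} ⋯ a_k^{t_k})`: for all sufficiently large
`q = p^e` there is `d ∈ a₁^{⌊t₁(q-1)⌋} ⋯ a_k^{⌊t_k(q-1)⌋}` such that
`d^{1/q} R → R^{1/q}` splits. -/
def FPurePair (R : Type*) [CommRing R] (p : ℕ) {k : ℕ}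
    (a : Fin k → Ideal R) (t : Fin k → ℝ) : Prop :=
  ∃ e₀ : ℕ, ∀ e : ℕ, e₀ ≤ e →
    ∃ d ∈ ∏ i, a i ^ ⌊t i * ((p ^ e : ℝ) - 1)⌋₊, SplitsAlong R d (p ^ e)

/-- Strong F-regularity of the pair `(R, a₁^{t₁} ⋯ a_k^{t_k})`: for every `c ∈ R°`
there are `q = p^e` and `d ∈ a₁^{⌊t₁(q-1)⌋} ⋯ a_k^{⌊t_k(q-1)⌋}` such that
`(cd)^{1/q} R → R^{1/q}` splits. -/
def StronglyFRegularPair (R : Type*) [CommRing R] (p : ℕ) {k : ℕ}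
    (a : Fin k → Ideal R) (t : Fin k → ℝ) : Prop :=
  ∀ c : R, NotInMinimalPrimes R c →
    ∃ e : ℕ, ∃ d ∈ ∏ i, a i ^ ⌊t i * ((p ^ e : ℝ) - 1)⌋₊, SplitsAlong R (c * d) (p ^ e)

/-- Pure F-regularity of the pair `(R, a₁^{t₁} ⋯ a_k^{t_k})`: for every `c ∈ R°` not
in any minimal prime of `a₁ ⋯ a_k`, for all sufficiently large `q = p^e` there is
`d ∈ a₁^{⌊t₁(q-1)⌋} ⋯ a_k^{⌊t_k(q-1)⌋}` such that `(cd)^{1/q} R → R^{1/q}` splits. -/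
def PurelyFRegularPair (R : Type*) [CommRing R] (p : ℕ) {k : ℕ}
    (a : Fin k → Ideal R) (t : Fin k → ℝ) : Prop :=
  ∀ c : R, NotInMinimalPrimes R c → (∀ P ∈ (∏ i, a i).minimalPrimes, c ∉ P) →
    ∃ e₀ : ℕ, ∀ e : ℕ, e₀ ≤ e →
      ∃ d ∈ ∏ i, a i ^ ⌊t i * ((p ^ e : ℝ) - 1)⌋₊, SplitsAlong R (c * d) (p ^ e)

/-- A strongly F-regular ring: for every `c ∈ R°` there is `q = p^e` such that
`c^{1/q} R → R^{1/q}` splits. -/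
def StronglyFRegularRing (R : Type*) [CommRing R] (p : ℕ) : Prop :=
  ∀ c : R, NotInMinimalPrimes R c → ∃ e : ℕ, SplitsAlong R c (p ^ e)

/-- The Frobenius power `J^{[q]}`, the ideal generated by `q`-th powers of elements
of `J`. -/
def frobeniusPower {R : Type*} [CommRing R] (J : Ideal R) (q : ℕ) : Ideal R :=
  Ideal.span ((fun x => x ^ q) '' (J : Set R))

/-- A regular local ring: a Noetherian local ring whose maximal ideal is generated
by `dim R` elements. -/
def IsRegularLocal (R : Type*) [CommRing R] [IsLocalRing R] : Prop :=
  IsNoetherianRing R ∧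
    ∃ s : Finset R, Ideal.span (s : Set R) = IsLocalRing.maximalIdeal R ∧
      (s.card : WithBot ℕ∞) = ringKrullDim R

/-- The height of a prime ideal. -/
noncomputable def primeHeight {R : Type*} [CommRing R] (P : Ideal R) (hP : P.IsPrime) : ℕ∞ :=
  Order.height (⟨P, hP⟩ : PrimeSpectrum R)

/-- `I` is an unmixed reduced ideal of height `h`: `I` is radical and every minimal
prime of `I` has height `h`. -/
def UnmixedReducedOfHeight {R : Type*} [CommRing R] (I : Ideal R) (h : ℕ) : Prop :=
  I.IsRadical ∧ ∀ (P : Ideal R) (hP : P.IsPrime), P ∈ I.minimalPrimes →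
    primeHeight P hP = (h : ℕ∞)

section FrobeniusSplitting

open IsLocalRing RingTheory.Sequence

theorem natCast_le_ringKrullDim_quotient_span_singleton {R : Type*} [CommRing R] [IsLocalRing R]
    [IsNoetherianRing R] {x : R} (hx : x ∈ maximalIdeal R) {n : ℕ}
    (hn : ((n + 1 : ℕ) : WithBot ℕ∞) ≤ ringKrullDim R) :
    (n : WithBot ℕ∞) ≤ ringKrullDim (R ⧸ Ideal.span {x}) := by
  have h := ringKrullDim_le_ringKrullDim_quotient_add_card ({x} : Finset R) (by
    simpa [IsLocalRing.ringJacobson_eq_maximalIdeal] using hx)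
  rw [Finset.coe_singleton, Finset.card_singleton] at h
  have h2 := hn.trans h
  rw [Nat.cast_add] at h2
  exact ENat.WithBot.add_le_add_natCast_right_iff.mp h2

/-- A regular local ring is a domain. -/
theorem isDomain_of_span_card_le_ringKrullDim (n : ℕ) :
    ∀ {R : Type*} [CommRing R] [IsLocalRing R] [IsNoetherianRing R] (s : Finset R),
      Ideal.span (s : Set R) = maximalIdeal R → s.card ≤ n → (n : WithBot ℕ∞) ≤ ringKrullDim R →
      IsDomain R := by
  classical
  induction n with
  | zero =>
    intro R _ _ _ s hs hc _
    obtain rfl : s = ∅ := by simpa using hc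
    have hm : maximalIdeal R = ⊥ := by rw [← hs]; simp
    exact (isField_iff_maximalIdeal_eq.mpr hm).isDomain
  | succ n ih =>
    intro R _ _ _ s hs hc hd
    have hdim : 0 < ringKrullDim R := lt_of_lt_of_le (by exact_mod_cast n.succ_pos) hd
    have hmin : maximalIdeal R ∉ minimalPrimes R := by
      intro hmem
      have h0 : (maximalIdeal R).height = 0 := by
        exact Ideal.height_eq_zero_iff.mpr hmem
      rw [← maximalIdeal_height_eq_ringKrullDim, h0] at hdim
      simp at hdim
    obtain ⟨x, hxm, hx2, hxP⟩ : ∃ x ∈ maximalIdeal R, x ∉ maximalIdeal R ^ 2 ∧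
        ∀ P ∈ minimalPrimes R, x ∉ P := by
      by_contra! hcon
      have hfin := minimalPrimes.finite_of_isNoetherianRing R
      have hsub : ((maximalIdeal R : Ideal R) : Set R) ⊆
          ⋃ P ∈ (↑(insert (maximalIdeal R ^ 2) hfin.toFinset) : Set (Ideal R)), (P : Set R) := by
        intro x hx
        by_cases h2 : x ∈ maximalIdeal R ^ 2
        · exact Set.mem_biUnion (x := maximalIdeal R ^ 2) (by simp) h2
        · obtain ⟨P, hP, hxP⟩ := hcon x hx h2
          exact Set.mem_biUnion (x := P) (by simp [hP]) hxP
      rw [Ideal.subset_union_prime (f := fun P => P) (maximalIdeal R ^ 2) (maximalIdeal R ^ 2)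
        (fun P hP hne _ => by
          have : P ∈ minimalPrimes R := by
            rcases Finset.mem_insert.mp hP with h | h
            · exact absurd h hne
            · simpa using h
          exact this.1.1)] at hsub
      obtain ⟨P, hP, hle⟩ := hsub
      rcases Finset.mem_insert.mp hP with rfl | h
      · have hbot : maximalIdeal R = ⊥ := by
          apply Submodule.eq_bot_of_le_smul_of_le_jacobson_bot (maximalIdeal R) _
            (IsNoetherian.noetherian _)
          · simpa [pow_two] using! hle
          · exact maximalIdeal_le_jacobson _
        have := (isField_iff_maximalIdeal_eq.mpr hbot)
        rw [ringKrullDim_eq_zero_of_isField this] at hdim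
        exact lt_irrefl _ hdim
      · have hP' : P ∈ minimalPrimes R := by simpa using h
        have : P.IsPrime := hP'.1.1
        obtain rfl : maximalIdeal R = P := le_antisymm hle (le_maximalIdeal this.ne_top)
        exact hmin hP'
    have hxs := hxm
    rw [← hs, Submodule.mem_span_finset'] at hxs
    obtain ⟨c, hcx⟩ := hxs
    obtain ⟨⟨y, hy⟩, hcy⟩ : ∃ y : s, IsUnit (c y) := by
      by_contra! hcon
      apply hx2
      rw [← hcx, pow_two]
      refine sum_mem fun y _ => Ideal.mul_mem_mul ((mem_maximalIdeal _).mpr (hcon y)) ?_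
      rw [← hs]; exact Ideal.subset_span y.2
    have hspan : maximalIdeal R = Ideal.span {x} ⊔ Ideal.span ((s.erase y : Finset R) : Set R) := by
      apply le_antisymm
      · rw [← hs, Ideal.span_le]
        intro z hz
        by_cases hzy : z = y
        · subst hzy
          rw [SetLike.mem_coe, ← Ideal.unit_mul_mem_iff_mem _ hcy]
          have hx' : c ⟨z, hy⟩ * z = x - ∑ w ∈ Finset.univ.erase (⟨z, hy⟩ : s), c w • (w : R) := by
            rw [← hcx, ← Finset.add_sum_erase _ _ (Finset.mem_univ (⟨z, hy⟩ : s))]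
            simp
          rw [hx']
          refine Ideal.sub_mem _ (Ideal.mem_sup_left (Ideal.mem_span_singleton_self x))
            (Ideal.mem_sup_right (sum_mem fun w hw => Ideal.mul_mem_left _ _
              (Ideal.subset_span ?_)))
          have : (w : R) ≠ z := fun h => (Finset.ne_of_mem_erase hw) (Subtype.ext h)
          simp [this]
        · exact Ideal.mem_sup_right (Ideal.subset_span (by simpa [hzy] using hz))
      · refine sup_le ((Ideal.span_singleton_le_iff_mem _).mpr hxm) (Ideal.span_le.mpr ?_)
        intro z hz
        rw [← hs]
        exact Ideal.subset_span (Finset.mem_of_mem_erase hz)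
    have hne : Ideal.span {x} ≠ ⊤ := fun h =>
      (maximalIdeal.isMaximal R).ne_top
        (top_le_iff.mp (h ▸ (Ideal.span_singleton_le_iff_mem _).mpr hxm))
    have : Nontrivial (R ⧸ Ideal.span {x}) := Ideal.Quotient.nontrivial_iff.mpr hne
    have : IsLocalRing (R ⧸ Ideal.span {x}) :=
      IsLocalRing.of_surjective' (Ideal.Quotient.mk _) Ideal.Quotient.mk_surjective
    have hdom : IsDomain (R ⧸ Ideal.span {x}) := by
      refine ih ((s.erase y).image (Ideal.Quotient.mk _)) ?_ ?_ ?_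
      · rw [Finset.coe_image, ← Ideal.map_span,
          ← map_maximalIdeal_of_surjective (Ideal.Quotient.mk (Ideal.span {x}))
            Ideal.Quotient.mk_surjective, hspan, Ideal.map_sup]
        simp
      · refine Finset.card_image_le.trans ?_
        rw [Finset.card_erase_of_mem hy]; omega
      · exact natCast_le_ringKrullDim_quotient_span_singleton hxm hd
    have hxprime : (Ideal.span {x}).IsPrime := (Ideal.Quotient.isDomain_iff_prime _).mp hdom
    obtain ⟨P, hP, hPx⟩ := Ideal.exists_minimalPrimes_le (bot_le : ⊥ ≤ Ideal.span {x})
    have hPp : P.IsPrime := hP.1.1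
    have hPbot : P = ⊥ := by
      apply Submodule.eq_bot_of_le_smul_of_le_jacobson_bot (Ideal.span {x}) _
        (IsNoetherian.noetherian _)
      · intro z hz
        obtain ⟨w, rfl⟩ := Ideal.mem_span_singleton'.mp (hPx hz)
        rw [smul_eq_mul, mul_comm w]
        exact Ideal.mul_mem_mul (Ideal.mem_span_singleton_self x)
          ((hPp.mem_or_mem hz).resolve_right (hxP P hP))
      · exact ((Ideal.span_singleton_le_iff_mem _).mpr hxm).trans (maximalIdeal_le_jacobson _)
    subst hPbot
    exact IsDomain.of_bot_isPrime R

theorem isWeaklyRegular_of_length_le_ringKrullDim (n : ℕ) :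
    ∀ {R : Type*} [CommRing R] [IsLocalRing R] [IsNoetherianRing R] (l : List R),
      Ideal.ofList l = maximalIdeal R → l.length = n → (n : WithBot ℕ∞) ≤ ringKrullDim R →
      IsWeaklyRegular R l := by
  classical
  induction n with
  | zero =>
    intro R _ _ _ l _ hl _
    obtain rfl := List.length_eq_zero_iff.mp hl
    exact IsWeaklyRegular.nil R R
  | succ n ih =>
    intro R _ _ _ l hl hlen hd
    obtain ⟨x, l, rfl⟩ := List.exists_cons_of_length_eq_add_one hlen
    have hlen' : l.length = n := by simpa using hlen
    have hdom : IsDomain R := by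
      refine isDomain_of_span_card_le_ringKrullDim (n + 1) (x :: l).toFinset ?_ ?_ hd
      · rw [← hl]; congr 1; ext; simp
      · exact (List.toFinset_card_le _).trans hlen.le
    have hxm : x ∈ maximalIdeal R := by
      rw [← hl]; exact Ideal.subset_span (by simp)
    have : Nontrivial (R ⧸ Ideal.span {x}) := Ideal.Quotient.nontrivial_iff.mpr fun h =>
      (maximalIdeal.isMaximal R).ne_top
        (top_le_iff.mp (h ▸ (Ideal.span_singleton_le_iff_mem _).mpr hxm))
    have : IsLocalRing (R ⧸ Ideal.span {x}) :=
      IsLocalRing.of_surjective' (Ideal.Quotient.mk _) Ideal.Quotient.mk_surjective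
    rw [isWeaklyRegular_cons_iff']
    constructor
    · have hx0 : x ≠ 0 := by
        rintro rfl
        have hm : Ideal.span (l.toFinset : Set R) = maximalIdeal R := by
          rw [← hl, Ideal.ofList_cons]; simp [Ideal.ofList]
        have h1 := ringKrullDim_le_spanFinrank_maximalIdeal R
        have h2 : (maximalIdeal R).spanFinrank ≤ n := by
          rw [← hm, ← hlen']
          refine (Submodule.spanFinrank_span_le_ncard_of_finite (Finset.finite_toSet _)).trans ?_
          rw [Set.ncard_coe_finset]
          exact List.toFinset_card_le _
        have h3 := hd.trans h1
        have : n + 1 ≤ (maximalIdeal R).spanFinrank := by exact_mod_cast h3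
        omega
      intro a b hab
      exact mul_left_cancel₀ hx0 hab
    · have key : IsWeaklyRegular (R ⧸ Ideal.span {x})
          (l.map (Ideal.Quotient.mk (Ideal.span {x}))) := by
        refine ih _ ?_ (by simpa using hlen') ?_
        · rw [← Ideal.map_ofList,
          ← map_maximalIdeal_of_surjective (Ideal.Quotient.mk (Ideal.span {x}))
            Ideal.Quotient.mk_surjective, ← hl, Ideal.ofList_cons, Ideal.map_sup]
          simp
        · exact natCast_le_ringKrullDim_quotient_span_singleton hxm hd
      rw [← Ideal.Quotient.algebraMap_eq, isWeaklyRegular_map_algebraMap_iff] at key ⊢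
      refine (LinearEquiv.isWeaklyRegular_congr (Submodule.quotEquivOfEq _ _ ?_) l).mp key
      rw [← Submodule.ideal_span_singleton_smul]
      simp

theorem isWeaklyRegular_map_pow_append {R : Type*} [CommRing R] [IsLocalRing R]
    [IsNoetherianRing R] (q : ℕ) (l₁ : List R) :
    ∀ l₂ : List R, (∀ r ∈ l₁ ++ l₂, r ∈ maximalIdeal R) → 0 < q → IsWeaklyRegular R (l₁ ++ l₂) →
      IsWeaklyRegular R (l₁.map (· ^ q) ++ l₂) := by
  induction l₁ with
  | nil => intro l₂ _ _ h; exact h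
  | cons x l₁ ih =>
    intro l₂ hm hq h
    have hxm : x ∈ maximalIdeal R := hm x (by simp)
    have hxq : x ^ q ∈ maximalIdeal R := Ideal.pow_mem_of_mem _ hxm q hq
    have h1 : IsWeaklyRegular R ((l₁ ++ l₂) ++ [x]) :=
      isWeaklyRegular_of_perm_of_subset_maximalIdeal h
        (List.perm_append_comm (l₁ := [x]) (l₂ := l₁ ++ l₂)) hm
    have h2 : IsWeaklyRegular R ((l₁ ++ l₂) ++ [x ^ q]) := by
      rw [isWeaklyRegular_append_iff, isWeaklyRegular_singleton_iff] at h1 ⊢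
      exact ⟨h1.1, h1.2.pow q⟩
    have hm2 : ∀ r ∈ l₁ ++ (l₂ ++ [x ^ q]), r ∈ maximalIdeal R := by
      intro r hr
      simp only [List.mem_append, List.mem_singleton] at hr
      rcases hr with hr | hr | rfl
      · exact hm r (by simp [hr])
      · exact hm r (by simp [hr])
      · exact hxq
    rw [List.append_assoc] at h2
    have h3 := ih (l₂ ++ [x ^ q]) hm2 hq h2
    rw [← List.append_assoc] at h3
    refine isWeaklyRegular_of_perm_of_subset_maximalIdeal h3
      (List.perm_append_comm (l₂ := [x ^ q])) ?_
    intro r hr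
    simp only [List.mem_append, List.mem_map, List.mem_singleton] at hr
    rcases hr with (⟨a, ha, rfl⟩ | hr) | rfl
    · exact Ideal.pow_mem_of_mem _ (hm a (by simp [ha])) q hq
    · exact hm r (by simp [hr])
    · exact hxq

theorem prod_pow_notMem_ofList_map_pow {R : Type*} [CommRing R] [IsLocalRing R]
    [IsNoetherianRing R] (n : ℕ) (l₁ : List R) :
    ∀ l₂ : List R, (∀ r ∈ l₁ ++ l₂, r ∈ maximalIdeal R) → IsWeaklyRegular R (l₁ ++ l₂) →
      l₁.prod ^ n ∉ Ideal.ofList (l₁.map (· ^ (n + 1)) ++ l₂) := by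
  induction l₁ with
  | nil =>
    intro l₂ hm _ h
    have hle : Ideal.ofList l₂ ≤ maximalIdeal R := Ideal.span_le.mpr hm
    simp only [List.prod_nil, one_pow, List.map_nil, List.nil_append] at h
    exact (Ideal.ne_top_iff_one _).mp (maximalIdeal.isMaximal R).ne_top (hle h)
  | cons x l₁ ih =>
    intro l₂ hm h hmem
    have hxm : x ∈ maximalIdeal R := hm x (by simp)
    have hm' : ∀ r ∈ l₁ ++ x :: l₂, r ∈ maximalIdeal R := fun r hr => hm r (by
      simp only [List.mem_append, List.mem_cons, List.cons_append] at hr ⊢; tauto)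
    have hperm : IsWeaklyRegular R (l₁ ++ x :: l₂) :=
      isWeaklyRegular_of_perm_of_subset_maximalIdeal h List.perm_middle.symm hm
    refine ih (x :: l₂) hm' hperm ?_
    have h2 : IsWeaklyRegular R (l₁ ++ (l₂ ++ [x])) := by
      rw [← List.append_assoc]
      exact isWeaklyRegular_of_perm_of_subset_maximalIdeal h
        (List.perm_append_comm (l₁ := [x]) (l₂ := l₁ ++ l₂)) hm
    have h3 := isWeaklyRegular_map_pow_append (n + 1) l₁ (l₂ ++ [x]) (fun r hr => hm' r (by
      simp only [List.mem_append, List.mem_cons] at hr ⊢; tauto))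
      n.succ_pos h2
    rw [← List.append_assoc, isWeaklyRegular_append_iff, isWeaklyRegular_singleton_iff] at h3
    set J := Ideal.ofList (l₁.map (· ^ (n + 1)) ++ l₂) with hJ
    have hreg : ∀ y : R, x ^ n * y ∈ J → y ∈ J := by
      intro y hy
      have hr := (h3.2.pow n)
      have hz : (Submodule.Quotient.mk y : R ⧸ (J • ⊤ : Submodule R R)) = 0 := by
        apply IsSMulRegular.right_eq_zero_of_smul hr
        rw [← Submodule.Quotient.mk_smul, Submodule.Quotient.mk_eq_zero]
        simpa using! hy
      simpa using! (Submodule.Quotient.mk_eq_zero _).mp hz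
    have hsplit : Ideal.ofList ((x :: l₁).map (· ^ (n + 1)) ++ l₂) =
        Ideal.span {x ^ (n + 1)} ⊔ J := by
      rw [List.map_cons, List.cons_append, Ideal.ofList_cons]
    have hgoal : Ideal.ofList (l₁.map (· ^ (n + 1)) ++ x :: l₂) = Ideal.span {x} ⊔ J := by
      rw [Ideal.ofList_append, Ideal.ofList_cons, hJ, Ideal.ofList_append]
      exact sup_left_comm _ _ _
    rw [hsplit, Ideal.mem_span_singleton_sup] at hmem
    rw [hgoal, Ideal.mem_span_singleton_sup]
    obtain ⟨a, j, hj, hab⟩ := hmem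
    refine ⟨a, l₁.prod ^ n - a * x, hreg _ ?_, by ring⟩
    rw [List.prod_cons, mul_pow] at hab
    have : x ^ n * (l₁.prod ^ n - a * x) = j := by
      rw [mul_sub, ← hab]; ring
    rwa [this]

theorem Module.free_of_isWeaklyRegular_of_ofList_eq_maximalIdeal (n : ℕ) :
    ∀ {R : Type*} [CommRing R] [IsLocalRing R] [IsNoetherianRing R] (l : List R)
      (M : Type*) [AddCommGroup M] [Module R M] [Module.Finite R M],
      Ideal.ofList l = maximalIdeal R → l.length = n → IsWeaklyRegular M l → Module.Free R M := by
  induction n with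
  | zero =>
    intro R _ _ _ l M _ _ _ hl hlen _
    obtain rfl := List.length_eq_zero_iff.mp hlen
    have hf : IsField R := isField_iff_maximalIdeal_eq.mpr (by rw [← hl]; simp)
    let := hf.toField
    exact Module.Free.of_divisionRing R M
  | succ n ih =>
    intro R _ _ _ l M _ _ _ hl hlen hreg
    obtain ⟨x, l, rfl⟩ := List.exists_cons_of_length_eq_add_one hlen
    have hxm : x ∈ maximalIdeal R := by
      rw [← hl]; exact Ideal.subset_span (by simp)
    have : Nontrivial (R ⧸ Ideal.span {x}) := Ideal.Quotient.nontrivial_iff.mpr fun h =>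
      (maximalIdeal.isMaximal R).ne_top
        (top_le_iff.mp (h ▸ (Ideal.span_singleton_le_iff_mem _).mpr hxm))
    have : IsLocalRing (R ⧸ Ideal.span {x}) :=
      IsLocalRing.of_surjective' (Ideal.Quotient.mk _) Ideal.Quotient.mk_surjective
    rw [isWeaklyRegular_cons_iff'] at hreg
    have := Module.finitePresentation_of_finite R M
    rw [← Module.free_quotSMulTop_iff_free R M (maximalIdeal_le_jacobson _ hxm) hreg.1]
    have := Module.Finite.of_restrictScalars_finite R (R ⧸ Ideal.span {x}) (QuotSMulTop x M)
    refine ih _ (QuotSMulTop x M) ?_ (by simpa using hlen) hreg.2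
    rw [← Ideal.map_ofList,
      ← map_maximalIdeal_of_surjective (Ideal.Quotient.mk (Ideal.span {x}))
        Ideal.Quotient.mk_surjective, ← hl, Ideal.ofList_cons, Ideal.map_sup]
    simp

/-- The monomial `∏ x i ^ a i` lies in every ideal of `R` strictly containing the one generated by
the `x i ^ (a i + 1)`, where the `x i` generate the maximal ideal. -/
theorem exists_mul_sub_prod_pow_mem {R : Type*} [CommRing R] [IsLocalRing R] {ι : Type*}
    [Fintype ι] (x : ι → R) (hx : Ideal.span (Set.range x) = maximalIdeal R) (N : ℕ) :
    ∀ (a : ι → ℕ), ∑ i, a i ≤ N → ∀ z, z ∉ Ideal.span (Set.range fun i => x i ^ (a i + 1)) →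
      ∃ r, r * z - ∏ i, x i ^ a i ∈ Ideal.span (Set.range fun i => x i ^ (a i + 1)) := by
  classical
  induction N with
  | zero =>
    intro a ha z hz
    have ha0 : ∀ i, a i = 0 := by simpa using ha
    simp only [ha0, zero_add, pow_one, pow_zero, Finset.prod_const_one] at hz ⊢
    have hu : IsUnit z := by
      by_contra h
      exact hz (hx.symm ▸ (mem_maximalIdeal z).mpr h)
    obtain ⟨r, hr⟩ := hu.exists_left_inv
    exact ⟨r, by simp [hr]⟩
  | succ N ih =>
    intro a ha z hz
    by_cases ha' : ∑ i, a i ≤ N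
    · exact ih a ha' z hz
    obtain ⟨i, hi⟩ : ∃ i, a i ≠ 0 := by
      by_contra! h
      simp [h] at ha'
    set J := Ideal.span (Set.range fun i => x i ^ (a i + 1)) with hJ
    have hmul : ∀ b, b < a i →
        ∀ w ∈ Ideal.span (Set.range fun j => x j ^ (Function.update a i b j + 1)),
          x i ^ (a i - b) * w ∈ J := by
      intro b hb w hw
      induction hw using Submodule.span_induction with
      | mem w hw =>
        obtain ⟨j, rfl⟩ := hw
        by_cases hj : j = i
        · subst hj
          apply Ideal.subset_span
          refine ⟨j, ?_⟩
          simp only [Function.update_self, ← pow_add]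
          congr 1; omega
        · refine Ideal.mul_mem_left _ _ (Ideal.subset_span ⟨j, ?_⟩)
          simp [Function.update_of_ne hj]
      | zero => simp
      | add u v _ _ hu hv => rw [mul_add]; exact J.add_mem hu hv
      | smul c u _ hu => rw [smul_eq_mul, mul_left_comm]; exact J.mul_mem_left _ hu
    have step : ∀ b, b < a i → ∀ z',
        z' ∉ Ideal.span (Set.range fun j => x j ^ (Function.update a i b j + 1)) →
        ∃ r, r * (x i ^ (a i - b) * z') - ∏ j, x j ^ a j ∈ J := by
      intro b hb z' hz'
      have hsum : ∑ j, Function.update a i b j ≤ N := by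
        have h1 := Finset.add_sum_erase Finset.univ a (Finset.mem_univ i)
        have h2 := Finset.add_sum_erase Finset.univ (Function.update a i b) (Finset.mem_univ i)
        have h3 : ∑ j ∈ Finset.univ.erase i, Function.update a i b j
            = ∑ j ∈ Finset.univ.erase i, a j :=
          Finset.sum_congr rfl fun j hj => by
            rw [Function.update_of_ne (Finset.ne_of_mem_erase hj)]
        rw [Function.update_self, h3] at h2
        omega
      obtain ⟨r, hr⟩ := ih _ hsum z' hz'
      have hprod : x i ^ (a i - b) * ∏ j, x j ^ Function.update a i b j = ∏ j, x j ^ a j := by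
        rw [← Finset.mul_prod_erase Finset.univ _ (Finset.mem_univ i),
          ← Finset.mul_prod_erase Finset.univ (fun j => x j ^ a j) (Finset.mem_univ i),
          ← mul_assoc, Function.update_self, ← pow_add, Nat.sub_add_cancel hb.le]
        congr 1
        exact Finset.prod_congr rfl fun j hj => by
          rw [Function.update_of_ne (Finset.ne_of_mem_erase hj)]
      refine ⟨r, ?_⟩
      have := hmul b hb _ hr
      rw [mul_sub, hprod] at this
      convert! this using 2
      ring
    by_cases hzx : z ∈ Ideal.span {x i} ⊔ J
    · obtain ⟨z', j, hj, rfl⟩ := Ideal.mem_span_singleton_sup.mp hzx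
      by_cases hz' : z' ∈ Ideal.span
          (Set.range fun j => x j ^ (Function.update a i (a i - 1) j + 1))
      · refine absurd (J.add_mem ?_ hj) hz
        have := hmul (a i - 1) (by omega) z' hz'
        rwa [show a i - (a i - 1) = 1 by omega, pow_one, mul_comm] at this
      · obtain ⟨r, hr⟩ := step (a i - 1) (by omega) z' hz'
        refine ⟨r, ?_⟩
        have h1 : a i - (a i - 1) = 1 := by omega
        rw [h1, pow_one] at hr
        have : r * (z' * x i + j) - ∏ j, x j ^ a j
            = (r * (x i * z') - ∏ j, x j ^ a j) + r * j := by ring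
        rw [this]
        exact J.add_mem hr (J.mul_mem_left _ hj)
    · have hz0 : z ∉ Ideal.span (Set.range fun j => x j ^ (Function.update a i 0 j + 1)) := by
        refine fun h => hzx (Ideal.span_le.mpr ?_ h)
        rintro _ ⟨j, rfl⟩
        by_cases hj : j = i
        · subst hj
          exact Ideal.mem_sup_left (by simp)
        · refine Ideal.mem_sup_right (Ideal.subset_span ⟨j, ?_⟩)
          simp [Function.update_of_ne hj]
      obtain ⟨r, hr⟩ := step 0 (by omega) z hz0
      refine ⟨r * x i ^ a i, ?_⟩
      rw [mul_assoc]
      simpa using hr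

section FreeAlgebra

variable {R S : Type*} [CommRing R] [CommRing S] [Algebra R S]

theorem Module.Basis.mem_map_of_repr_mem {ι : Type*} [Fintype ι] (b : Module.Basis ι R S)
    {I : Ideal R} {z : S} (hz : ∀ i, b.repr z i ∈ I) : z ∈ I.map (algebraMap R S) := by
  rw [← b.sum_repr z]
  refine sum_mem fun i _ => ?_
  rw [Algebra.smul_def]
  exact Ideal.mul_mem_right _ _ (Ideal.mem_map_of_mem _ (hz i))

theorem Ideal.linearMap_mem_of_mem_map {I : Ideal R} (φ : S →ₗ[R] R) {z : S}
    (hz : z ∈ I.map (algebraMap R S)) : φ z ∈ I := by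
  have h : z ∈ (I • (⊤ : Submodule R S)) := by
    rw [Ideal.smul_top_eq_map]; exact hz
  exact Submodule.smul_induction_on h
    (fun r hr n _ => by rw [map_smul]; exact Ideal.mul_mem_right _ _ hr)
    (fun x y hx hy => by rw [map_add]; exact Ideal.add_mem _ hx hy)

theorem Matrix.mulVec_of_linearMap_mul {ι : Type*} [Fintype ι] (b : ι → S) (T : S →ₗ[R] R)
    (w : ι → R) (i : ι) :
    (Matrix.of fun i j => T (b i * b j)).mulVec w i = T ((∑ j, w j • b j) * b i) := by
  simp only [Matrix.mulVec, dotProduct, Matrix.of_apply, Finset.sum_mul, map_sum,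
    smul_mul_assoc, map_smul, smul_eq_mul]
  exact Finset.sum_congr rfl fun j _ => by rw [mul_comm (b i), mul_comm]

variable [IsLocalRing R]

theorem exists_linearMap_eq_one_of_notMem [Module.Free R S] [Module.Finite R S] {z : S}
    (hz : z ∉ (maximalIdeal R).map (algebraMap R S)) : ∃ φ : S →ₗ[R] R, φ z = 1 := by
  let b := Module.Free.chooseBasis R S
  obtain ⟨i, hi⟩ : ∃ i, b.repr z i ∉ maximalIdeal R := by
    by_contra! h
    exact hz (b.mem_map_of_repr_mem h)
  obtain ⟨v, hv⟩ := (notMem_maximalIdeal.mp hi).exists_left_inv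
  exact ⟨v • b.coord i, by simpa using hv⟩

theorem exists_linearMap_forall_exists_isUnit [Module.Free R S] [Module.Finite R S] {s : S}
    (hs : s ∉ (maximalIdeal R).map (algebraMap R S))
    (hsoc : ∀ z ∉ (maximalIdeal R).map (algebraMap R S),
      ∃ r, r * z - s ∈ (maximalIdeal R).map (algebraMap R S)) :
    ∃ T : S →ₗ[R] R, ∀ z ∉ (maximalIdeal R).map (algebraMap R S), ∃ r, IsUnit (T (z * r)) := by
  obtain ⟨T, hT⟩ := exists_linearMap_eq_one_of_notMem hs
  refine ⟨T, fun z hz => ?_⟩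
  obtain ⟨r, hr⟩ := hsoc z hz
  refine ⟨r, ?_⟩
  have h := Ideal.linearMap_mem_of_mem_map T hr
  rw [map_sub, hT] at h
  rw [mul_comm]
  by_contra hn
  exact (Ideal.ne_top_iff_one _).mp (maximalIdeal.isMaximal R).ne_top
    (by simpa using Ideal.sub_mem _ ((mem_maximalIdeal _).mpr hn) h)

theorem isUnit_det_of_forall_exists_isUnit {ι : Type*} [Fintype ι] [DecidableEq ι]
    (b : Module.Basis ι R S) {T : S →ₗ[R] R}
    (hT : ∀ z ∉ (maximalIdeal R).map (algebraMap R S), ∃ r, IsUnit (T (z * r))) :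
    IsUnit (Matrix.of fun i j => T (b i * b j)).det := by
  by_contra hdet
  set G := Matrix.of fun i j => T (b i * b j) with hG
  have h0 : (G.map (residue R)).det = 0 := by
    rw [← RingHom.mapMatrix_apply, ← RingHom.map_det, residue_eq_zero_iff]
    exact (mem_maximalIdeal _).mpr hdet
  obtain ⟨v, hv0, hv⟩ := Matrix.exists_mulVec_eq_zero_iff.mpr h0
  choose w hw using fun i => residue_surjective (v i)
  have hwv : residue R ∘ w = v := funext hw
  have hz : ∑ i, w i • b i ∉ (maximalIdeal R).map (algebraMap R S) := by
    intro hmem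
    refine hv0 (funext fun i => ?_)
    have := Ideal.linearMap_mem_of_mem_map (b.coord i) hmem
    rw [Module.Basis.coord_apply, b.repr_sum_self, ← residue_eq_zero_iff, hw] at this
    exact this
  obtain ⟨r, hr⟩ := hT _ hz
  refine (mem_maximalIdeal _).mp ?_ hr
  have hbi : ∀ i, T ((∑ j, w j • b j) * b i) ∈ maximalIdeal R := by
    intro i
    rw [← Matrix.mulVec_of_linearMap_mul, ← hG, ← residue_eq_zero_iff, RingHom.map_mulVec,
      hwv, hv]
    rfl
  rw [← b.sum_repr r, Finset.mul_sum, map_sum]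
  refine sum_mem fun i _ => ?_
  rw [mul_smul_comm, map_smul]
  exact Ideal.mul_mem_left _ _ (hbi i)

variable [Module.Free R S] [Module.Finite R S] {T : S →ₗ[R] R}

theorem exists_forall_eq_mul_of_forall_exists_isUnit
    (hT : ∀ z ∉ (maximalIdeal R).map (algebraMap R S), ∃ r, IsUnit (T (z * r)))
    (φ : S →ₗ[R] R) : ∃ u, ∀ z, φ z = T (u * z) := by
  classical
  let b := Module.Free.chooseBasis R S
  have hdet := isUnit_det_of_forall_exists_isUnit b hT
  set G := Matrix.of fun i j => T (b i * b j) with hG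
  let w := G⁻¹.mulVec fun i => φ (b i)
  have hGw : G.mulVec w = fun i => φ (b i) := by
    rw [Matrix.mulVec_mulVec, Matrix.mul_nonsing_inv _ hdet, Matrix.one_mulVec]
  refine ⟨∑ j, w j • b j, fun z => ?_⟩
  have : φ = T ∘ₗ LinearMap.mulLeft R (∑ j, w j • b j) := by
    refine b.ext fun i => ?_
    rw [← congrFun hGw i, hG, Matrix.mulVec_of_linearMap_mul]
    rfl
  exact congrArg (fun f : S →ₗ[R] R => f z) this

theorem mem_map_of_forall_mul_mem
    (hT : ∀ z ∉ (maximalIdeal R).map (algebraMap R S), ∃ r, IsUnit (T (z * r)))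
    {I : Ideal R} {z : S} (hz : ∀ r, T (z * r) ∈ I) : z ∈ I.map (algebraMap R S) := by
  classical
  let b := Module.Free.chooseBasis R S
  have hdet := isUnit_det_of_forall_exists_isUnit b hT
  set G := Matrix.of fun i j => T (b i * b j) with hG
  refine b.mem_map_of_repr_mem fun i => ?_
  have hGw : G.mulVec (b.repr z) = fun i => T (z * b i) := by
    funext i
    rw [hG, Matrix.mulVec_of_linearMap_mul, b.sum_repr]
  have : (b.repr z : _ → R) = G⁻¹.mulVec fun i => T (z * b i) := by
    rw [← hGw, Matrix.mulVec_mulVec, Matrix.nonsing_inv_mul _ hdet, Matrix.one_mulVec]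
  rw [this]
  exact sum_mem fun j _ => Ideal.mul_mem_left _ _ (hz _)

end FreeAlgebra

section FrobeniusAlgebra

/-- The ring `R` regarded as an `R`-algebra through the `e`-fold Frobenius endomorphism. -/
def FrobeniusAlgebra (R : Type*) (_p _e : ℕ) : Type _ := R

variable {R : Type*} [CommRing R] {p : ℕ}

instance (e : ℕ) : CommRing (FrobeniusAlgebra R p e) := inferInstanceAs (CommRing R)

noncomputable instance [ExpChar R p] (e : ℕ) : Algebra R (FrobeniusAlgebra R p e) :=
  RingHom.toAlgebra (S := FrobeniusAlgebra R p e) (iterateFrobenius R p e)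

theorem FFinite.finite_frobenius [ExpChar R p] (h : FFinite R p) : (frobenius R p).Finite := by
  have hle : ∀ x, frobenius R p x ∈ pthPowers R p := fun x => Subring.subset_closure ⟨x, rfl⟩
  have hsub : (pthPowers R p).subtype.Finite := h
  have hsurj : Function.Surjective ((frobenius R p).codRestrict (pthPowers R p) hle) := by
    rintro ⟨y, hy⟩
    have : pthPowers R p ≤ (frobenius R p).range := by
      rw [pthPowers, Subring.closure_le]
      rintro _ ⟨x, rfl⟩
      exact ⟨x, rfl⟩
    obtain ⟨x, rfl⟩ := this hy
    exact ⟨x, rfl⟩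
  exact hsub.comp (RingHom.Finite.of_surjective _ hsurj)

theorem FFinite.finite_iterateFrobenius [ExpChar R p] (h : FFinite R p) (e : ℕ) :
    (iterateFrobenius R p e).Finite := by
  induction e with
  | zero =>
    rw [iterateFrobenius_zero]
    exact RingHom.Finite.id R
  | succ e ih =>
    rw [iterateFrobenius_add, iterateFrobenius_one]
    exact ih.comp h.finite_frobenius

theorem FFinite.finite_frobeniusAlgebra [ExpChar R p] (h : FFinite R p) (e : ℕ) :
    Module.Finite R (FrobeniusAlgebra R p e) :=
  h.finite_iterateFrobenius e

theorem map_maximalIdeal_frobeniusAlgebra [IsLocalRing R] [ExpChar R p] (e : ℕ) {l : List R}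
    (hl : Ideal.ofList l = maximalIdeal R) :
    (maximalIdeal R).map (algebraMap R (FrobeniusAlgebra R p e)) =
      (Ideal.ofList (l.map (· ^ p ^ e)) : Ideal R) := by
  rw [← hl, Ideal.map_ofList]
  rfl

variable [IsLocalRing R] [IsNoetherianRing R]

theorem free_frobeniusAlgebra [Fact p.Prime] [ExpChar R p] (e : ℕ)
    [Module.Finite R (FrobeniusAlgebra R p e)] {l : List R} (hl : Ideal.ofList l = maximalIdeal R)
    (hreg : IsWeaklyRegular R l) : Module.Free R (FrobeniusAlgebra R p e) := by
  refine Module.free_of_isWeaklyRegular_of_ofList_eq_maximalIdeal _ l _ hl rfl ?_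
  rw [← isWeaklyRegular_map_algebraMap_iff (FrobeniusAlgebra R p e)]
  have h := isWeaklyRegular_map_pow_append (p ^ e) l []
    (fun r hr => hl ▸ Ideal.subset_span (by simpa using hr)) (pow_pos (Fact.out : p.Prime).pos _)
    (by simpa using hreg)
  rw [List.append_nil] at h
  exact h

theorem exists_trace_frobeniusAlgebra [Fact p.Prime] [ExpChar R p] (e : ℕ)
    [Module.Finite R (FrobeniusAlgebra R p e)] [Module.Free R (FrobeniusAlgebra R p e)]
    {l : List R} (hl : Ideal.ofList l = maximalIdeal R) (hreg : IsWeaklyRegular R l) :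
    ∃ T : FrobeniusAlgebra R p e →ₗ[R] R,
      ∀ z ∉ (maximalIdeal R).map (algebraMap R (FrobeniusAlgebra R p e)),
        ∃ r, IsUnit (T (z * r)) := by
  obtain ⟨n, hn⟩ : ∃ n, p ^ e = n + 1 :=
    Nat.exists_eq_add_one.mpr (pow_pos (Fact.out : p.Prime).pos _)
  have hmap := map_maximalIdeal_frobeniusAlgebra (p := p) e hl
  rw [hn] at hmap
  have hrange : (Ideal.ofList (l.map (· ^ (n + 1))) : Ideal R) =
      Ideal.span (Set.range fun i => l.get i ^ (n + 1)) := by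
    rw [Ideal.ofList]
    congr 1
    ext x
    simp [List.mem_iff_get, Fin.exists_iff]
  refine exists_linearMap_forall_exists_isUnit (s := (l.prod ^ n : R)) ?_ ?_
  · rw [hmap]
    have h := prod_pow_notMem_ofList_map_pow n l []
      (fun r hr => hl ▸ Ideal.subset_span (by simpa using hr)) (by simpa using hreg)
    rwa [List.append_nil] at h
  · rw [hmap, hrange]
    have hx : Ideal.span (Set.range l.get) = maximalIdeal R := by
      rw [← hl, Ideal.ofList]
      congr 1
      ext x
      simp
    intro z hz
    obtain ⟨r, hr⟩ := exists_mul_sub_prod_pow_mem l.get hx _ (fun _ => n) le_rfl z hz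
    refine ⟨r, ?_⟩
    rwa [Finset.prod_pow, show ∏ i, l.get i = l.prod by simp] at hr

end FrobeniusAlgebra

section FrobeniusColon

variable {R : Type*} [CommRing R] {p : ℕ}

theorem Ideal.map_mul_mem_map_of_forall_mul_mem {S : Type*} [CommRing S] (f : R →+* S)
    {I K : Ideal R} {c : R} (hc : ∀ y ∈ I, c * y ∈ K) {w : S} (hw : w ∈ I.map f) :
    f c * w ∈ K.map f := by
  have h : Ideal.span {c} * I ≤ K := Ideal.span_singleton_mul_le_iff.mpr hc
  have h2 := Ideal.map_mono (f := f) h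
  rw [Ideal.map_mul, Ideal.map_span, Set.image_singleton] at h2
  exact Ideal.span_singleton_mul_le_iff.mp h2 w hw

theorem exists_forall_pow_mul_mem_map_iterateFrobenius [ExpChar R p] {I : Ideal R} {e n : ℕ}
    (hn : p ^ e = n + 1) {u : R} (hu : ∀ y ∈ I, u * y ∈ I.map (iterateFrobenius R p e)) (j : ℕ) :
    ∃ N, N * n + 1 = p ^ (e * j) ∧ ∀ y ∈ I, u ^ N * y ∈ I.map (iterateFrobenius R p (e * j)) := by
  induction j with
  | zero => exact ⟨0, by simp, fun y hy => by simpa [iterateFrobenius_zero] using! hy⟩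
  | succ j ih =>
    obtain ⟨N, hN, h⟩ := ih
    refine ⟨N * (n + 1) + 1, ?_, fun y hy => ?_⟩
    · rw [mul_add_one e, pow_add, ← hN, hn]
      ring
    · rw [mul_add_one e, add_comm, iterateFrobenius_add, ← Ideal.map_map]
      have := Ideal.map_mul_mem_map_of_forall_mul_mem (iterateFrobenius R p e) h (hu y hy)
      rw [iterateFrobenius_def, hn, ← pow_mul, ← mul_assoc, ← pow_succ] at this
      exact this

theorem pow_mul_mem_map_iterateFrobenius_pow [ExpChar R p] {I : Ideal R} {e n : ℕ}
    (hn : p ^ e = n + 1) {u : R} (hu : ∀ y ∈ I, u * y ∈ I.map (iterateFrobenius R p e)) (j : ℕ)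
    {y : R} (hy : y ∈ I ^ n) :
    u ^ p ^ (e * j) * y ∈ (I ^ n).map (iterateFrobenius R p (e * j)) := by
  obtain ⟨N, hN, h⟩ := exists_forall_pow_mul_mem_map_iterateFrobenius hn hu j
  have hle := Ideal.pow_right_mono (Ideal.span_singleton_mul_le_iff.mpr h) n
  rw [mul_pow, Ideal.span_singleton_pow, ← Ideal.map_pow] at hle
  rw [← hN, pow_succ', mul_assoc, pow_mul]
  exact Ideal.mul_mem_left _ _ (Ideal.span_singleton_mul_le_iff.mp hle y hy)

/-- Over a regular local ring, `(I^{[q]} : I) ⊆ I ^ (q - 1)`. -/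
theorem mem_pow_of_forall_mul_mem_map_iterateFrobenius [IsLocalRing R] [IsNoetherianRing R]
    [IsDomain R] [Fact p.Prime] [ExpChar R p]
    (hfin : ∀ e, Module.Finite R (FrobeniusAlgebra R p e))
    (hfree : ∀ e, Module.Free R (FrobeniusAlgebra R p e)) {I : Ideal R} (hI : I ≠ ⊥) {e : ℕ}
    {u : R} (hu : ∀ y ∈ I, u * y ∈ I.map (iterateFrobenius R p e)) : u ∈ I ^ (p ^ e - 1) := by
  have hp := (Fact.out : p.Prime)
  obtain ⟨n, hn⟩ : ∃ n, p ^ e = n + 1 := Nat.exists_eq_add_one.mpr (pow_pos hp.pos _)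
  rw [hn, Nat.add_sub_cancel]
  rcases Nat.eq_zero_or_pos e with rfl | he
  · obtain rfl : n = 0 := by simpa using hn
    simp
  obtain ⟨y, hy, hy0⟩ := Submodule.exists_mem_ne_zero_of_ne_bot (pow_ne_zero n hI : I ^ n ≠ ⊥)
  obtain ⟨N, hN⟩ : ∃ N, y ∉ maximalIdeal R ^ N := by
    by_contra! h
    refine hy0 ?_
    rw [← Ideal.mem_bot, ← Ideal.iInf_pow_eq_bot_of_isLocalRing (maximalIdeal R)
      (maximalIdeal.isMaximal R).ne_top]
    exact Ideal.mem_iInf.mpr h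
  have hNe : N ≤ p ^ (e * N) :=
    (Nat.lt_pow_self hp.one_lt).le.trans
      (Nat.pow_le_pow_right hp.pos (Nat.le_mul_of_pos_left N he))
  have hynot : y ∉ (maximalIdeal R).map (algebraMap R (FrobeniusAlgebra R p (e * N))) := by
    refine fun h => hN (Ideal.pow_le_pow_right hNe ?_)
    refine (Ideal.map_le_iff_le_comap.mpr fun x hx => ?_ :
      (maximalIdeal R).map (iterateFrobenius R p (e * N)) ≤ _) h
    exact Ideal.pow_mem_pow hx _
  have := hfin (e * N)
  have := hfree (e * N)
  obtain ⟨φ, hφ⟩ := exists_linearMap_eq_one_of_notMem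
    (S := FrobeniusAlgebra R p (e * N)) hynot
  have h := Ideal.linearMap_mem_of_mem_map φ
    (z := u • (show FrobeniusAlgebra R p (e * N) from y))
    (pow_mul_mem_map_iterateFrobenius_pow hn hu N hy)
  rw [map_smul] at h
  rw [← mul_one u, ← hφ]
  exact h

end FrobeniusColon

section Quotient

variable {R : Type*} [CommRing R]

theorem IsRegularLocal.isDomain [IsLocalRing R] (h : IsRegularLocal R) : IsDomain R := by
  obtain ⟨_, s, hs, hcard⟩ := h
  exact isDomain_of_span_card_le_ringKrullDim s.card s hs le_rfl hcard.le

theorem IsRegularLocal.exists_isWeaklyRegular [IsLocalRing R] (h : IsRegularLocal R) :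
    ∃ l : List R, Ideal.ofList l = maximalIdeal R ∧ IsWeaklyRegular R l := by
  obtain ⟨_, s, hs, hcard⟩ := h
  have hl : Ideal.ofList s.toList = maximalIdeal R := by
    rw [← hs, Ideal.ofList]
    congr 1
    ext x
    simp
  exact ⟨s.toList, hl, isWeaklyRegular_of_length_le_ringKrullDim s.card _ hl
    s.length_toList hcard.le⟩

theorem UnmixedReducedOfHeight.ne_bot [IsDomain R] {I : Ideal R} {h : ℕ}
    (hI : UnmixedReducedOfHeight I h) (hh : 0 < h) : I ≠ ⊥ := by
  rintro rfl
  have hmin : (⊥ : Ideal R) ∈ (⊥ : Ideal R).minimalPrimes :=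
    ⟨⟨Ideal.isPrime_bot, le_rfl⟩, fun _ _ _ => bot_le⟩
  have h0 := hI.2 ⊥ Ideal.isPrime_bot hmin
  have h1 : primeHeight (⊥ : Ideal R) Ideal.isPrime_bot = 0 :=
    Order.height_eq_zero.mpr fun Q _ => (bot_le : ⊥ ≤ Q.asIdeal)
  rw [h1] at h0
  exact hh.ne (by exact_mod_cast h0)

theorem exists_linearMap_frobeniusAlgebra_of_quotient {p e : ℕ} [ExpChar R p] {I : Ideal R}
    [Module.Free R (FrobeniusAlgebra R p e)] {ψ : R ⧸ I →+ R ⧸ I}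
    (hψ : ∀ a x, ψ (a ^ p ^ e * x) = a * ψ x) :
    ∃ φ : FrobeniusAlgebra R p e →ₗ[R] R,
      ∀ x : R, Ideal.Quotient.mk I (φ x) = ψ (Ideal.Quotient.mk I x) := by
  have hadd (x y : R) : ψ (Ideal.Quotient.mk I (x + y)) =
      ψ (Ideal.Quotient.mk I x) + ψ (Ideal.Quotient.mk I y) := by
    rw [map_add, map_add]
  have hsmul (a x : R) : ψ (Ideal.Quotient.mk I (a ^ p ^ e * x)) =
      a • ψ (Ideal.Quotient.mk I x) := by
    rw [map_mul, map_pow, hψ, Algebra.smul_def, Ideal.Quotient.algebraMap_eq]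
  let g : FrobeniusAlgebra R p e →ₗ[R] R ⧸ I :=
    { toFun := fun x => ψ (Ideal.Quotient.mk I x)
      map_add' := hadd
      map_smul' := hsmul }
  obtain ⟨φ, hφ⟩ := Module.projective_lifting_property I.mkQ g I.mkQ_surjective
  exact ⟨φ, fun x => congrArg (fun f => f x) hφ⟩

theorem splitsAlong_of_isUnit {p e : ℕ} [ExpChar R p] (T : FrobeniusAlgebra R p e →ₗ[R] R)
    {c : R} (hc : IsUnit (T c)) : SplitsAlong R c (p ^ e) := by
  obtain ⟨v, hv⟩ := hc.exists_left_inv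
  exact ⟨(v • T).toAddMonoidHom, fun a x => (v • T).map_smul a x, hv⟩

theorem exists_mem_pow_splitsAlong_mul [IsLocalRing R] {p : ℕ} [Fact p.Prime] [ExpChar R p]
    (hreg : IsRegularLocal R) (hFF : FFinite R p) {I : Ideal R} (hIne : I ≠ ⊤) (hI : I ≠ ⊥)
    {e : ℕ} {d : R} (hd : SplitsAlong (R ⧸ I) (Ideal.Quotient.mk I d) (p ^ e)) :
    ∃ u ∈ I ^ (p ^ e - 1), SplitsAlong R (u * d) (p ^ e) := by
  have := hreg.isDomain
  have := hreg.1
  obtain ⟨l, hl, hlreg⟩ := hreg.exists_isWeaklyRegular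
  have hfin := fun e => hFF.finite_frobeniusAlgebra e
  have hfree := fun e => free_frobeniusAlgebra (p := p) e hl hlreg
  obtain ⟨T, hT⟩ := exists_trace_frobeniusAlgebra (p := p) e hl hlreg
  obtain ⟨ψ, hψ, hψd⟩ := hd
  obtain ⟨φ, hφ⟩ := exists_linearMap_frobeniusAlgebra_of_quotient hψ
  obtain ⟨u, hu⟩ : ∃ u : R, ∀ z : R, φ z = T (u * z : R) :=
    exists_forall_eq_mul_of_forall_exists_isUnit hT φ
  refine ⟨u, mem_pow_of_forall_mul_mem_map_iterateFrobenius hfin hfree hI fun y hy => ?_,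
    splitsAlong_of_isUnit T ?_⟩
  · refine mem_map_of_forall_mul_mem hT (z := (u * y : R)) fun (r : R) => ?_
    change T (u * y * r : R) ∈ I
    have hy0 : Ideal.Quotient.mk I (y * r : R) = 0 :=
      Ideal.Quotient.eq_zero_iff_mem.mpr (Ideal.mul_mem_right _ _ hy)
    have h := hφ (y * r : R)
    rw [hy0, map_zero, Ideal.Quotient.eq_zero_iff_mem, hu] at h
    rw [mul_assoc]
    exact h
  · have h : T (u * d : R) - 1 ∈ I := by
      rw [← Ideal.Quotient.mk_eq_mk_iff_sub_mem, map_one, ← hψd, ← hφ, hu]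
    by_contra hn
    refine (Ideal.ne_top_iff_one _).mp (maximalIdeal.isMaximal R).ne_top ?_
    simpa using! Ideal.sub_mem _ ((mem_maximalIdeal _).mpr hn) (le_maximalIdeal hIne h)

theorem Ideal.map_finsetProd_pow {S ι : Type*} [CommRing S] (f : R →+* S) (s : Finset ι)
    (a : ι → Ideal R) (n : ι → ℕ) :
    (∏ i ∈ s, a i ^ n i).map f = ∏ i ∈ s, (a i).map f ^ n i := by
  rw [← Ideal.mapHom_apply, map_prod]
  simp [Ideal.map_pow]

end Quotient

end FrobeniusSplitting

/-- F-inversion of adjunction, F-pure case. If `(S, (a₁S)^{t₁} ⋯ (a_kS)^{t_k})`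
is F-pure, then `(R, I¹ a₁^{t₁} ⋯ a_k^{t_k})` is F-pure. -/
theorem fInversion_fPure {R : Type*} [CommRing R] [IsLocalRing R] (p : ℕ)
    [Fact p.Prime] [CharP R p] (hreg : IsRegularLocal R) (hFF : FFinite R p)
    (I : Ideal R) (hIne : I ≠ ⊤) (h : ℕ) (hh : 0 < h)
    (hI : UnmixedReducedOfHeight I h) {k : ℕ}
    (a : Fin k → Ideal R) (t : Fin k → ℝ) (ht : ∀ i, 0 < t i)
    (hS : FPurePair (R ⧸ I) p (fun i => (a i).map (Ideal.Quotient.mk I)) t) :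
    FPurePair R p (Fin.cons I a) (Fin.cons (1 : ℝ) t) := by
  have := hreg.isDomain
  obtain ⟨e₀, he₀⟩ := hS
  refine ⟨e₀, fun e he => ?_⟩
  obtain ⟨c, hc, hsplit⟩ := he₀ e he
  rw [← Ideal.map_finsetProd_pow,
    Ideal.mem_map_iff_of_surjective _ Ideal.Quotient.mk_surjective] at hc
  obtain ⟨d, hd, rfl⟩ := hc
  obtain ⟨u, hu, hud⟩ := exists_mem_pow_splitsAlong_mul hreg hFF hIne (hI.ne_bot hh) hsplit
  refine ⟨u * d, ?_, hud⟩
  have hfloor : ⌊(1 : ℝ) * ((p : ℝ) ^ e - 1)⌋₊ = p ^ e - 1 := by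
    rw [one_mul, ← Nat.cast_pow, ← Nat.cast_one, Nat.floor_sub_natCast, Nat.floor_natCast]
  rw [Fin.prod_univ_succ]
  simp only [Fin.cons_zero, Fin.cons_succ, hfloor]
  exact Ideal.mul_mem_mul hu hd
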